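/- For every nonempty word x over the positive integers, the atomic factors of C(x) are exactly the atomic factors of the words C(u), where u ranges over the atomic factors of x; equivalently, if x splits into atoms u_1, …, u_r, then concatenating the atomic decompositions of C(u_1), …, C(u_r) yields the atomic decomposition of C(x). -/

import Mathlib

/-- The look-and-say (audioactive) derivation: replace each maximal run of
`k` consecutive equal symbols `a` in the word by the two symbols `k, a`. -/
def lookAndSay (x : List ℕ+) : List ℕ+ :=
  (x.splitBy (· == ·)).flatMap fun r => [r.length.toPNat', r.headD 1]

/-- `x` splits into the list of factors `us`. -/
def SplitsInto (x : List ℕ+) (us : List (List ℕ+)) : Prop :=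
  x = us.flatten ∧ ∀ n : ℕ, lookAndSay^[n] x = (us.map fun u => lookAndSay^[n] u).flatten

/-- An atom: a nonempty word that does not split as the concatenation of two
nonempty words. -/
def IsAtomWord (x : List ℕ+) : Prop :=
  x ≠ [] ∧ ¬ ∃ u v : List ℕ+, u ≠ [] ∧ v ≠ [] ∧ x = u ++ v ∧
    ∀ n : ℕ, lookAndSay^[n] x = lookAndSay^[n] u ++ lookAndSay^[n] v

/-- `u` is an atomic factor of `x`: it occurs in a splitting of `x` into atoms. -/
def AtomicFactor (u x : List ℕ+) : Prop :=
  ∃ us : List (List ℕ+), (∀ w ∈ us, IsAtomWord w) ∧ SplitsInto x us ∧ u ∈ us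

/-- The number of maximal runs of a word. -/
def LSruns : List ℕ+ → ℕ
  | [] => 0
  | [_] => 1
  | a :: b :: l => if a = b then LSruns (b :: l) else LSruns (b :: l) + 1

theorem LSruns_loop (l : List ℕ+) : ∀ (a : ℕ+) (g : List ℕ+) (gs : List (List ℕ+)),
    (List.splitBy.loop (· == ·) l a g gs).length = gs.length + LSruns (a :: l) := by
  induction l with
  | nil => intro a g gs; simp [List.splitBy.loop, LSruns]
  | cons b l ih =>
    intro a g gs
    by_cases h : a = b
    · subst h
      simp [List.splitBy.loop, LSruns, ih]
    · have h' : (a == b) = false := by simpa using h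
      simp only [List.splitBy.loop, LSruns, h', ih, if_neg h, List.length_cons]
      omega

theorem LSlength (x : List ℕ+) : (lookAndSay x).length = 2 * LSruns x := by
  have h : (x.splitBy (· == ·)).length = LSruns x := by
    cases x with
    | nil => rfl
    | cons a l => simp [List.splitBy, LSruns_loop]
  rw [← h, lookAndSay, List.length_flatMap]
  simp [mul_comm]

theorem LSruns_append (u : List ℕ+) (a : ℕ+) (v : List ℕ+) :
    LSruns (u ++ a :: a :: v) + 1 = LSruns (u ++ [a]) + LSruns (a :: v) := by
  induction u with
  | nil => simp [LSruns]; omega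
  | cons b u ih =>
    cases u with
    | nil =>
      simp only [List.cons_append, List.nil_append, LSruns, if_true] at ih ⊢
      split_ifs <;> omega
    | cons c u =>
      simp only [List.cons_append, LSruns] at ih ⊢
      split_ifs <;> omega

theorem LSappend (u v : List ℕ+) (h : ∀ x ∈ u.getLast?, ∀ y ∈ v.head?, x ≠ y) :
    lookAndSay (u ++ v) = lookAndSay u ++ lookAndSay v := by
  unfold lookAndSay
  rw [List.splitBy_append, List.flatMap_append]
  intro x hx y hy
  simpa using h x hx y hy

theorem LSlength_append (u v : List ℕ+) (h : ¬ ∀ x ∈ u.getLast?, ∀ y ∈ v.head?, x ≠ y) :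
    (lookAndSay (u ++ v)).length + 2 = (lookAndSay u).length + (lookAndSay v).length := by
  push Not at h
  obtain ⟨a, ha, b, hb, rfl⟩ := h
  obtain ⟨u', rfl⟩ := List.mem_getLast?_eq_getLast ha |> fun ⟨h1, h2⟩ =>
    (⟨u.dropLast, by rw [h2]; exact (List.dropLast_append_getLast h1).symm⟩ : ∃ u', u = u' ++ [a])
  cases v with
  | nil => simp at hb
  | cons c v =>
    simp at hb
    subst hb
    have := LSruns_append u' c v
    simp only [LSlength, List.append_assoc, List.cons_append, List.nil_append]
    omega

theorem LSappend_iff (u v : List ℕ+) :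
    lookAndSay (u ++ v) = lookAndSay u ++ lookAndSay v ↔
      ∀ x ∈ u.getLast?, ∀ y ∈ v.head?, x ≠ y := by
  refine ⟨fun h => ?_, LSappend u v⟩
  by_contra hn
  have := LSlength_append u v hn
  rw [h, List.length_append] at this
  omega

theorem LSlength_le (u v : List ℕ+) :
    (lookAndSay (u ++ v)).length ≤ (lookAndSay u).length + (lookAndSay v).length := by
  by_cases h : ∀ x ∈ u.getLast?, ∀ y ∈ v.head?, x ≠ y
  · rw [LSappend u v h, List.length_append]
  · have := LSlength_append u v h
    omega

theorem LSnil : lookAndSay [] = [] := rfl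

theorem LSiter_nil (n : ℕ) : lookAndSay^[n] [] = [] := Function.iterate_fixed LSnil n

theorem LSgetLast (x : List ℕ+) : (lookAndSay x).getLast? = x.getLast? := by
  rcases List.eq_nil_or_concat (x.splitBy (· == ·)) with h | ⟨gs, g, h⟩
  · rw [List.splitBy_eq_nil] at h
    subst h; rfl
  · have hg : g ∈ x.splitBy (· == ·) := by rw [h]; simp
    have hne := List.ne_nil_of_mem_splitBy hg
    have hc := List.isChain_of_mem_splitBy hg
    have hx : x = gs.flatten ++ g := by
      have := List.flatten_splitBy (· == ·) x
      rw [h] at this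
      simpa using this.symm
    have key : ∀ (t : List ℕ+) (a : ℕ+), (a :: t).IsChain (fun x y => (x == y) = true) →
        (a :: t).getLast? = some a := by
      intro t
      induction t with
      | nil => intro a _; rfl
      | cons b t ih =>
        intro a hc
        rw [List.isChain_cons_cons] at hc
        have hab : a = b := by simpa using hc.1
        subst hab
        rw [List.getLast?_cons_cons]
        exact ih a hc.2
    unfold lookAndSay
    rw [h]
    obtain ⟨a, t, rfl⟩ := List.exists_cons_of_ne_nil hne
    have hk := key t a hc
    rw [hx, List.getLast?_append, hk]
    simp

theorem LSiter_getLast (n : ℕ) (x : List ℕ+) : (lookAndSay^[n] x).getLast? = x.getLast? := by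
  induction n with
  | zero => rfl
  | succ n ih => rw [Function.iterate_succ_apply', LSgetLast, ih]

/-- The boundary between `u` and `v` is a splitting. -/
def LSB (u v : List ℕ+) : Prop :=
  ∀ n : ℕ, lookAndSay^[n] (u ++ v) = lookAndSay^[n] u ++ lookAndSay^[n] v

theorem LSB_iff (u v : List ℕ+) :
    LSB u v ↔ ∀ n, ∀ x ∈ u.getLast?, ∀ y ∈ (lookAndSay^[n] v).head?, x ≠ y := by
  constructor
  · intro h n
    have h1 := h (n + 1)
    simp only [Function.iterate_succ_apply'] at h1
    rw [h n, LSappend_iff, LSiter_getLast] at h1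
    exact h1
  · intro h n
    induction n with
    | zero => rfl
    | succ n ih =>
      simp only [Function.iterate_succ_apply']
      rw [ih, LSappend_iff, LSiter_getLast]
      exact h n

theorem LSne_nil (n : ℕ) (x : List ℕ+) (h : x ≠ []) : lookAndSay^[n] x ≠ [] := by
  intro h'
  have := LSiter_getLast n x
  rw [h'] at this
  simp only [List.getLast?_nil] at this
  exact h (List.getLast?_eq_none_iff.1 this.symm)

theorem LSB_mid (u t w : List ℕ+) (ht : t ≠ []) (h1 : LSB u (t ++ w)) (h2 : LSB (u ++ t) w) :
    LSB u t := by
  have h3 : LSB t w := by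
    rw [LSB_iff] at h2 ⊢
    intro n x hx
    apply h2 n x
    rw [List.getLast?_append]
    simp_all
  rw [LSB_iff] at h1 ⊢
  intro n x hx y hy
  apply h1 n x hx
  rw [h3 n, List.head?_append_of_ne_nil _ (LSne_nil n t ht)]
  exact hy

theorem LSlength_flatten (ws : List (List ℕ+)) :
    (lookAndSay ws.flatten).length ≤ ((ws.map lookAndSay).flatten).length := by
  induction ws with
  | nil => simp [LSnil]
  | cons w ws ih =>
    simp only [List.flatten_cons, List.map_cons, List.length_append]
    have := LSlength_le w ws.flatten
    omega

theorem LSflatten_cons (w : List ℕ+) (ws : List (List ℕ+))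
    (h : lookAndSay (w ++ ws.flatten) = lookAndSay w ++ (ws.map lookAndSay).flatten) :
    lookAndSay ws.flatten = (ws.map lookAndSay).flatten := by
  have h1 := LSlength_flatten ws
  have h2 : (lookAndSay (w ++ ws.flatten)).length
      = (lookAndSay w).length + ((ws.map lookAndSay).flatten).length := by
    rw [h, List.length_append]
  by_cases hb : ∀ x ∈ w.getLast?, ∀ y ∈ ws.flatten.head?, x ≠ y
  · rw [LSappend w _ hb] at h
    exact List.append_cancel_left h
  · have := LSlength_append _ _ hb
    omega

theorem LSsplits_cons (x u : List ℕ+) (us : List (List ℕ+)) :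
    SplitsInto x (u :: us) ↔ x = u ++ us.flatten ∧ LSB u us.flatten ∧
      SplitsInto us.flatten us := by
  constructor
  · rintro ⟨rfl, h⟩
    have ht : SplitsInto us.flatten us := by
      refine ⟨rfl, fun n => ?_⟩
      induction n with
      | zero => simp
      | succ n ih =>
        have h1 := h (n + 1)
        rw [Function.iterate_succ_apply', h n] at h1
        have h2 := LSflatten_cons (lookAndSay^[n] u) (us.map fun u => lookAndSay^[n] u) (by
          simpa [Function.iterate_succ_apply', Function.comp_def] using h1)
        rw [Function.iterate_succ_apply', ih, h2]
        simp [Function.iterate_succ_apply', Function.comp_def]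
    refine ⟨rfl, fun n => ?_, ht⟩
    have := h n
    simp only [List.flatten_cons, List.map_cons] at this
    rw [this, ht.2 n]
  · rintro ⟨rfl, hb, ht⟩
    refine ⟨rfl, fun n => ?_⟩
    rw [hb n, ht.2 n]
    rfl

theorem LSatom_iff (x : List ℕ+) :
    IsAtomWord x ↔ x ≠ [] ∧ ∀ u v, u ≠ [] → v ≠ [] → x = u ++ v → ¬ LSB u v := by
  unfold IsAtomWord LSB
  refine and_congr_right fun _ => ?_
  constructor
  · rintro h u v hu hv rfl hb
    exact h ⟨u, v, hu, hv, rfl, hb⟩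
  · rintro h ⟨u, v, hu, hv, rfl, hb⟩
    exact h u v hu hv rfl hb

theorem LSunique (us : List (List ℕ+)) : ∀ (x : List ℕ+) (vs : List (List ℕ+)),
    (∀ w ∈ us, IsAtomWord w) → (∀ w ∈ vs, IsAtomWord w) →
    SplitsInto x us → SplitsInto x vs → us = vs := by
  have aux : ∀ (u t U V : List ℕ+), IsAtomWord u → IsAtomWord (u ++ t) → U = t ++ V →
      LSB u U → LSB (u ++ t) V → t = [] := by
    rintro u t U V hu hut rfl h1 h2
    by_contra ht
    exact ((LSatom_iff _).1 hut).2 u t hu.1 ht rfl (LSB_mid u t V ht h1 h2)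
  induction us with
  | nil =>
    intro x vs _ hv h1 h2
    cases vs with
    | nil => rfl
    | cons v vs =>
      have h3 := h2.1
      rw [h1.1] at h3
      have := (hv v (by simp)).1
      simp_all
  | cons u us ih =>
    intro x vs hu hv h1 h2
    cases vs with
    | nil =>
      have h3 := h1.1
      rw [h2.1] at h3
      have := (hu u (by simp)).1
      simp_all
    | cons v vs =>
      rw [LSsplits_cons] at h1 h2
      obtain ⟨rfl, hb1, hs1⟩ := h1
      obtain ⟨e, hb2, hs2⟩ := h2
      have hu0 := hu u (by simp)
      have hv0 := hv v (by simp)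
      have huv : u = v := by
        rcases List.append_eq_append_iff.1 e with ⟨t, ht, e'⟩ | ⟨t, ht, e'⟩
        · subst ht
          simp [aux u t _ _ hu0 hv0 e' hb1 hb2]
        · subst ht
          simp [aux v t _ _ hv0 hu0 e' hb2 hb1]
      subst huv
      have e2 := List.append_cancel_left e
      rw [ih _ vs (fun w hw => hu w (by simp [hw])) (fun w hw => hv w (by simp [hw]))
        hs1 (by rw [e2]; exact hs2)]

theorem LSsplits_flatMap (x : List ℕ+) (us : List (List ℕ+)) (f : List ℕ+ → List (List ℕ+))
    (h : SplitsInto x us) (hf : ∀ u ∈ us, SplitsInto u (f u)) :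
    SplitsInto x (us.flatMap f) := by
  have key : ∀ n, (us.map fun u => lookAndSay^[n] u).flatten =
      ((us.flatMap f).map fun u => lookAndSay^[n] u).flatten := by
    intro n
    clear h
    induction us with
    | nil => rfl
    | cons u us ih =>
      simp only [List.map_cons, List.flatten_cons, List.flatMap_cons, List.map_append,
        List.flatten_append]
      rw [ih (fun w hw => hf w (by simp [hw])), (hf u (by simp)).2 n]
  refine ⟨?_, fun n => by rw [h.2 n, key n]⟩
  have := key 0
  simp only [Function.iterate_zero, id, List.map_id'] at this
  rw [h.1, this]

theorem LSexists (m : ℕ) : ∀ x : List ℕ+, x.length ≤ m →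
    ∃ us : List (List ℕ+), (∀ w ∈ us, IsAtomWord w) ∧ SplitsInto x us := by
  induction m with
  | zero =>
    intro x hx
    have : x = [] := by simpa using hx
    subst this
    exact ⟨[], by simp, by simp, fun n => by simp [LSiter_nil]⟩
  | succ m ih =>
    intro x hx
    by_cases h0 : x = []
    · exact ih x (by simp [h0])
    by_cases ha : IsAtomWord x
    · exact ⟨[x], by simpa using ha, by simp, fun n => by simp⟩
    · rw [LSatom_iff] at ha
      push Not at ha
      obtain ⟨u, v, hu, hv, rfl, hb⟩ := ha h0
      have h1 := List.length_pos_iff.2 hu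
      have h2 := List.length_pos_iff.2 hv
      rw [List.length_append] at hx
      obtain ⟨us, hus, hsu⟩ := ih u (by omega)
      obtain ⟨vs, hvs, hsv⟩ := ih v (by omega)
      refine ⟨us ++ vs, ?_, ?_, fun n => ?_⟩
      · intro w hw
        rcases List.mem_append.1 hw with hw | hw
        · exact hus w hw
        · exact hvs w hw
      · rw [List.flatten_append, ← hsu.1, ← hsv.1]
      · rw [hb n, List.map_append, List.flatten_append, hsu.2 n, hsv.2 n]

theorem LSsplits_image (x : List ℕ+) (us : List (List ℕ+)) (h : SplitsInto x us) :
    SplitsInto (lookAndSay x) (us.map lookAndSay) := by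
  refine ⟨by simpa using h.2 1, fun n => ?_⟩
  have := h.2 (n + 1)
  simpa [Function.iterate_succ_apply, Function.comp_def] using this

theorem LSsplits_combine (x : List ℕ+) (us : List (List ℕ+)) (f : List ℕ+ → List (List ℕ+))
    (h : SplitsInto x us) (hf : ∀ u ∈ us, SplitsInto (lookAndSay u) (f (lookAndSay u))) :
    SplitsInto (lookAndSay x) ((us.map lookAndSay).flatMap f) := by
  apply LSsplits_flatMap _ _ _ (LSsplits_image x us h)
  intro w hw
  obtain ⟨u, hu, rfl⟩ := List.mem_map.1 hw
  exact hf u hu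

/-- The atomic factors of `C(x)` are exactly the atomic factors of the words
`C(u)`, where `u` ranges over the atomic factors of `x`. -/
theorem atomicFactors_lookAndSay (x : List ℕ+) (hx : x ≠ []) :
    {v : List ℕ+ | AtomicFactor v (lookAndSay x)} =
      {v : List ℕ+ | ∃ u : List ℕ+, AtomicFactor u x ∧ AtomicFactor v (lookAndSay u)} := by
  choose f hfa hfs using fun x : List ℕ+ => LSexists x.length x le_rfl
  have hatoms : ∀ us : List (List ℕ+), ∀ w ∈ us.flatMap f, IsAtomWord w := by
    intro us w hw
    obtain ⟨u, _, hw⟩ := List.mem_flatMap.1 hw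
    exact hfa u w hw
  ext v
  constructor
  · rintro ⟨vs, hva, hvs, hv⟩
    have h1 := LSsplits_combine x (f x) f (hfs x) (fun u _ => hfs _)
    have h2 := LSunique _ _ _ hva (hatoms _) hvs h1
    rw [h2] at hv
    obtain ⟨w, hw, hv⟩ := List.mem_flatMap.1 hv
    obtain ⟨u, hu, rfl⟩ := List.mem_map.1 hw
    exact ⟨u, ⟨f x, hfa x, hfs x, hu⟩, ⟨f _, hfa _, hfs _, hv⟩⟩
  · rintro ⟨u, ⟨us, hua, hus, hu⟩, ⟨vs, hva, hvs, hv⟩⟩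
    have h1 := LSsplits_combine x us f hus (fun u _ => hfs _)
    refine ⟨_, hatoms _, h1, ?_⟩
    rw [LSunique _ _ _ hva (hfa _) hvs (hfs _)] at hv
    exact List.mem_flatMap.2 ⟨_, List.mem_map.2 ⟨u, hu, rfl⟩, hv⟩
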